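/- arXiv:1712.07090 — 2 statements merged into one kernel-verified Lean document; each statement's English description precedes it below -/
import Mathlib

section
/- Let Y be an infinite dimensional Banach space and let X₁,…,X_m be infinite dimensional Banach spaces with normalized unconditional Schauder bases (x_n^{(k)}), k = 1,…,m; let q > 0 and p ≥ 1. Suppose Y finitely factors the formal inclusion ℓ_p → ℓ_∞ for some 0 < δ < 1, and suppose every continuous m-linear mapping from X₁ × ⋯ × X_m into Y is absolutely (q;1)-summing. Then: (a) if q < p, then for every t > pq/(p−q) and all x_k = ∑_j a_j^{(k)} x_j^{(k)} ∈ X_k (k = 1,…,m) one has ∑_j (∏_{k=1}^m |a_j^{(k)}|)^t < ∞; (b) if q ≤ p/2, then the same holds for every t > q. -/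
open scoped BigOperators

/-- A sequence in a normed space is *weakly 1-summable*. -/
def WeaklySummable (𝕂 : Type*) [RCLike 𝕂] {X : Type*} [NormedAddCommGroup X]
    [NormedSpace 𝕂 X] (x : ℕ → X) : Prop :=
  ∀ φ : X →L[𝕂] 𝕂, Summable fun j => ‖φ (x j)‖

/-- `e` is a normalized unconditional Schauder basis of `X`. -/
def IsNormalizedUncondBasis (𝕂 : Type*) [RCLike 𝕂] (X : Type*) [NormedAddCommGroup X]
    [NormedSpace 𝕂 X] (e : ℕ → X) : Prop :=
  (∀ n, ‖e n‖ = 1) ∧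
  (∀ x : X, ∃! a : ℕ → 𝕂, HasSum (fun n => a n • e n) x) ∧
  ∃ ρ : ℝ, 1 ≤ ρ ∧ ∀ (a ε : ℕ → 𝕂) (x y : X),
    (∀ n, ε n = 1 ∨ ε n = -1) →
    HasSum (fun n => a n • e n) x → HasSum (fun n => (ε n * a n) • e n) y →
    ‖y‖ ≤ ρ * ‖x‖

/-- `Y` finitely factors the formal inclusion `ℓ_p → ℓ_∞` for `δ`. -/
def FinitelyFactorsLpLinf (𝕂 : Type*) [RCLike 𝕂] (Y : Type*) [NormedAddCommGroup Y]
    [NormedSpace 𝕂 Y] (p δ : ℝ) : Prop :=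
  ∀ n : ℕ, ∃ y : Fin n → Y, ∀ a : Fin n → 𝕂,
    (1 - δ) * (⨆ j, ‖a j‖) ≤ ‖∑ j, a j • y j‖ ∧
    ‖∑ j, a j • y j‖ ≤ (∑ j, ‖a j‖ ^ p) ^ (1 / p)



/-- The coordinate functionals of a normalized unconditional basis are linear and uniformly
bounded. -/
theorem IsNormalizedUncondBasis.exists_coord {𝕂 : Type*} [RCLike 𝕂] {X : Type*}
    [NormedAddCommGroup X] [NormedSpace 𝕂 X] {e : ℕ → X}
    (he : IsNormalizedUncondBasis 𝕂 X e) :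
    ∃ (f : ℕ → X →L[𝕂] 𝕂) (C : ℝ), 0 ≤ C ∧ (∀ n x, ‖f n x‖ ≤ C * ‖x‖) ∧
      (∀ x, HasSum (fun n => f n x • e n) x) ∧
      ∀ (x : X) (a : ℕ → 𝕂), HasSum (fun n => a n • e n) x → ∀ n, f n x = a n := by
  obtain ⟨hnorm, huniq, ρ, hρ, hsign⟩ := he
  choose c hc hcu using huniq
  simp only at hc hcu
  have hbound : ∀ n x, ‖c x n‖ ≤ (1 + ρ) * ‖x‖ := by
    intro n x
    have hflip : HasSum (fun i => ((if i = n then -1 else 1 : 𝕂) * c x i) • e i)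
        (x - (2 * c x n) • e n) := by
      have h1 := (hc x).sub (hasSum_ite_eq n ((2 * c x n) • e n))
      convert h1 using 1
      funext i
      by_cases h : i = n
      · subst h
        simp only [if_true, ← sub_smul]
        congr 1
        ring
      · simp [h]
    have h2 := hsign (c x) (fun i => if i = n then -1 else 1) x _
      (fun i => by by_cases h : i = n <;> simp [h]) (hc x) hflip
    have h3 : ‖(2 * c x n) • e n‖ = 2 * ‖c x n‖ := by
      rw [norm_smul, norm_mul, hnorm, RCLike.norm_ofNat, mul_one]
    have h4 : ‖(2 * c x n) • e n‖ ≤ ‖x‖ + ‖x - (2 * c x n) • e n‖ := by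
      simpa using norm_sub_le x (x - (2 * c x n) • e n)
    nlinarith [norm_nonneg (c x n)]
  refine ⟨fun n => LinearMap.mkContinuous
    { toFun := fun x => c x n
      map_add' := fun x y => ?_
      map_smul' := fun r x => ?_ } (1 + ρ) (hbound n), 1 + ρ, by linarith, hbound, hc, ?_⟩
  · have h := hcu (x + y) (fun n => c x n + c y n) (by
      simpa only [add_smul] using (hc x).add (hc y))
    exact (congrFun h n).symm
  · have h := hcu (r • x) (fun n => r * c x n) (by
      simpa only [mul_smul] using (hc x).const_smul r)
    exact (congrFun h n).symm
  · intro x a ha n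
    exact (congrFun (hcu x a ha) n).symm

theorem HasSum.weaklySummable {𝕂 : Type*} [RCLike 𝕂] {X : Type*}
    [NormedAddCommGroup X] [NormedSpace 𝕂 X] {u : ℕ → X} {x : X} (h : HasSum u x) :
    WeaklySummable 𝕂 u := fun φ =>
  summable_norm_iff.2 (φ.hasSum h).summable

theorem Real.add_rpow_le_two_rpow_mul {a b q : ℝ} (ha : 0 ≤ a) (hb : 0 ≤ b) (hq : 0 < q) :
    (a + b) ^ q ≤ 2 ^ q * (a ^ q + b ^ q) := by
  have h1 : (a + b) ^ q ≤ (2 * max a b) ^ q :=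
    Real.rpow_le_rpow (by positivity)
      (by linarith [le_max_left a b, le_max_right a b]) hq.le
  rw [Real.mul_rpow (by norm_num) (le_max_of_le_left ha)] at h1
  refine h1.trans ?_
  gcongr
  rcases max_choice a b with h | h <;> rw [h]
  · linarith [Real.rpow_nonneg hb q]
  · linarith [Real.rpow_nonneg ha q]

/-- A uniform boundedness principle for sequences of operators whose values are absolutely
`q`-summable at every point. -/
theorem exists_sum_rpow_norm_le_of_summable {𝕂 : Type*} [RCLike 𝕂] {E Y : Type*}
    [NormedAddCommGroup E] [NormedSpace 𝕂 E] [CompleteSpace E]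
    [NormedAddCommGroup Y] [NormedSpace 𝕂 Y] {q : ℝ} (hq : 0 < q) (L : ℕ → E →L[𝕂] Y)
    (hL : ∀ T, Summable fun j => ‖L j T‖ ^ q) :
    ∃ K : ℝ, 0 ≤ K ∧ ∀ (T : E) (n : ℕ), ∑ j : Fin n, ‖L j T‖ ^ q ≤ K * ‖T‖ ^ q := by
  let A : ℕ → Set E := fun N => ⋂ n : ℕ, {T | ∑ j : Fin n, ‖L j T‖ ^ q ≤ N}
  have hclosed : ∀ N, IsClosed (A N) := fun N => isClosed_iInter fun n => by
    refine isClosed_le (continuous_finsetSum _ fun j _ => ?_) continuous_const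
    exact (L j).continuous.norm.rpow_const fun _ => Or.inr hq.le
  have hcover : ⋃ N, A N = Set.univ := by
    refine Set.eq_univ_of_forall fun T => ?_
    obtain ⟨N, hN⟩ := exists_nat_ge (∑' j, ‖L j T‖ ^ q)
    refine Set.mem_iUnion.2 ⟨N, Set.mem_iInter.2 fun n => ?_⟩
    refine le_trans ?_ hN
    rw [Fin.sum_univ_eq_sum_range (fun j => ‖L j T‖ ^ q) n]
    exact (hL T).sum_le_tsum _ fun _ _ => by positivity
  obtain ⟨N, T₀, hT₀⟩ := nonempty_interior_of_iUnion_of_closed hclosed hcover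
  obtain ⟨r, hr, hball⟩ := Metric.mem_nhds_iff.1 (mem_interior_iff_mem_nhds.1 hT₀)
  have hmem : ∀ T ∈ A N, ∀ n : ℕ, ∑ j : Fin n, ‖L j T‖ ^ q ≤ N := fun T hT n =>
    Set.mem_iInter.1 hT n
  have hsmall : ∀ T : E, ‖T‖ < r → ∀ n : ℕ,
      ∑ j : Fin n, ‖L j T‖ ^ q ≤ 2 ^ q * (N + N) := by
    intro T hT n
    have h1 := hmem (T₀ + T) (hball (by simpa using hT)) n
    have h2 := hmem T₀ (hball (Metric.mem_ball_self hr)) n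
    calc ∑ j : Fin n, ‖L j T‖ ^ q
        ≤ ∑ j : Fin n, 2 ^ q * (‖L j (T₀ + T)‖ ^ q + ‖L j T₀‖ ^ q) := by
          refine Finset.sum_le_sum fun j _ => ?_
          refine le_trans (Real.rpow_le_rpow (norm_nonneg _) ?_ hq.le)
            (Real.add_rpow_le_two_rpow_mul (norm_nonneg _) (norm_nonneg _) hq)
          simpa using norm_sub_le (L j (T₀ + T)) (L j T₀)
      _ ≤ 2 ^ q * (N + N) := by
          rw [← Finset.mul_sum, Finset.sum_add_distrib]
          gcongr
  refine ⟨2 ^ q * (N + N) * (2 / r) ^ q, by positivity, fun T n => ?_⟩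
  rcases eq_or_ne T 0 with rfl | hT
  · simp [Real.zero_rpow hq.ne']
  have hT' : 0 < ‖T‖ := norm_pos_iff.2 hT
  have hnorm : ‖((r / (2 * ‖T‖) : ℝ) : 𝕂)‖ = r / (2 * ‖T‖) := by
    rw [RCLike.norm_ofReal, abs_of_pos (by positivity)]
  have h := hsmall (((r / (2 * ‖T‖) : ℝ) : 𝕂) • T) (by
    rw [norm_smul, hnorm]
    field_simp
    norm_num) n
  simp only [map_smul, norm_smul, hnorm] at h
  simp only [Real.mul_rpow (show (0 : ℝ) ≤ r / (2 * ‖T‖) by positivity) (norm_nonneg _)] at h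
  rw [← Finset.mul_sum] at h
  have hinv : (r / (2 * ‖T‖)) ^ q * ((2 / r) ^ q * ‖T‖ ^ q) = 1 := by
    rw [← Real.mul_rpow (by positivity) (by positivity),
      ← Real.mul_rpow (by positivity) (by positivity),
      show r / (2 * ‖T‖) * (2 / r * ‖T‖) = 1 by field_simp, Real.one_rpow]
  calc ∑ j : Fin n, ‖L j T‖ ^ q
      = ((r / (2 * ‖T‖)) ^ q * ∑ j : Fin n, ‖L j T‖ ^ q) * ((2 / r) ^ q * ‖T‖ ^ q) := by
        linear_combination (-(∑ j : Fin n, ‖L j T‖ ^ q)) * hinv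
    _ ≤ (2 ^ q * (N + N)) * ((2 / r) ^ q * ‖T‖ ^ q) := by gcongr
    _ = 2 ^ q * (N + N) * (2 / r) ^ q * ‖T‖ ^ q := by ring

/-- The Banach–Steinhaus theorem for sequences of continuous multilinear maps. -/
theorem ContinuousMultilinearMap.banach_steinhaus {𝕂 : Type*} [RCLike 𝕂] {ι : Type*} [Fintype ι]
    {X : ι → Type*} [∀ k, NormedAddCommGroup (X k)] [∀ k, NormedSpace 𝕂 (X k)]
    [∀ k, CompleteSpace (X k)] {Y : Type*} [NormedAddCommGroup Y] [NormedSpace 𝕂 Y]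
    (T : ℕ → ContinuousMultilinearMap 𝕂 X Y) (hT : ∀ x, ∃ C : ℝ, ∀ n, ‖T n x‖ ≤ C) :
    ∃ M : ℝ, 0 ≤ M ∧ ∀ n, ‖T n‖ ≤ M := by
  classical
  let A : ℕ → Set (∀ k, X k) := fun N => ⋂ n : ℕ, {x | ‖T n x‖ ≤ N}
  have hclosed : ∀ N, IsClosed (A N) := fun N => isClosed_iInter fun n =>
    isClosed_le (T n).cont.norm continuous_const
  have hcover : ⋃ N, A N = Set.univ := by
    refine Set.eq_univ_of_forall fun x => ?_
    obtain ⟨C, hC⟩ := hT x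
    obtain ⟨N, hN⟩ := exists_nat_ge C
    exact Set.mem_iUnion.2 ⟨N, Set.mem_iInter.2 fun n => (hC n).trans hN⟩
  obtain ⟨N, x₀, hx₀⟩ := nonempty_interior_of_iUnion_of_closed hclosed hcover
  obtain ⟨r, hr, hball⟩ := Metric.mem_nhds_iff.1 (mem_interior_iff_mem_nhds.1 hx₀)
  have hsmall : ∀ n (h : ∀ k, X k), (∀ k, ‖h k‖ < r) →
      ‖T n h‖ ≤ Fintype.card (Finset ι) * (N : ℝ) := by
    intro n h hh
    have hexp : T n h = ∑ s : Finset ι, T n (s.piecewise (x₀ + h) (-x₀)) := by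
      rw [← (T n).map_add_univ]
      congr 1
      abel
    rw [hexp]
    refine (norm_sum_le _ _).trans ?_
    have hterm : ∀ s : Finset ι, ‖T n (s.piecewise (x₀ + h) (-x₀))‖ ≤ N := by
      intro s
      have heq : s.piecewise (x₀ + h) (-x₀) =
          fun k => (if k ∈ s then 1 else -1 : 𝕂) • s.piecewise (x₀ + h) x₀ k := by
        funext k
        by_cases hk : k ∈ s <;> simp [hk]
      have hone : ‖∏ k, (if k ∈ s then 1 else -1 : 𝕂)‖ = 1 := by
        rw [norm_prod]
        refine Finset.prod_eq_one fun k _ => ?_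
        by_cases hk : k ∈ s <;> simp [hk]
      rw [heq, (T n).map_smul_univ, norm_smul, hone, one_mul]
      refine Set.mem_iInter.1 (hball ?_) n
      rw [Metric.mem_ball, dist_eq_norm, pi_norm_lt_iff hr]
      intro k
      by_cases hk : k ∈ s <;> simp [hk, hh k, hr]
    calc ∑ s : Finset ι, ‖T n (s.piecewise (x₀ + h) (-x₀))‖
        ≤ ∑ _s : Finset ι, (N : ℝ) := Finset.sum_le_sum fun s _ => hterm s
      _ = _ := by simp
  refine ⟨Fintype.card (Finset ι) * (N : ℝ) / (r / 2) ^ Fintype.card ι, by positivity,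
    fun n => ContinuousMultilinearMap.opNorm_le_bound (by positivity) ?_⟩
  refine MultilinearMap.bound_of_shell (T n).toMultilinearMap (ε := fun _ => r)
    (c := fun _ => (2 : 𝕂)) (fun _ => hr) (fun _ => by simp) fun h hlow hup => ?_
  refine (hsmall n h hup).trans ?_
  rw [div_mul_eq_mul_div, le_div_iff₀ (by positivity)]
  gcongr
  rw [← Finset.card_univ, ← Finset.prod_const]
  exact Finset.prod_le_prod (fun _ _ => by positivity) fun k _ => by simpa using hlow k

section Diagonal

variable {𝕂 : Type*} [RCLike 𝕂] {m : ℕ} {X : Fin m → Type*}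
  [∀ k, NormedAddCommGroup (X k)] [∀ k, NormedSpace 𝕂 (X k)]
  {Y : Type*} [NormedAddCommGroup Y] [NormedSpace 𝕂 Y]

/-- The finite rank multilinear map `x ↦ ∑ j, (∏ k, f k j (x k)) • z j`. -/
noncomputable def diagonalMultilinear (f : ∀ k, ℕ → X k →L[𝕂] 𝕂) {n : ℕ} (z : Fin n → Y) :
    ContinuousMultilinearMap 𝕂 X Y :=
  ∑ j : Fin n, ((ContinuousMultilinearMap.mkPiAlgebra 𝕂 (Fin m) 𝕂).compContinuousLinearMap
    fun k => f k j).smulRight (z j)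

theorem diagonalMultilinear_apply (f : ∀ k, ℕ → X k →L[𝕂] 𝕂) {n : ℕ} (z : Fin n → Y)
    (x : ∀ k, X k) :
    diagonalMultilinear f z x = ∑ j : Fin n, (∏ k, f k j (x k)) • z j := by
  simp [diagonalMultilinear]

theorem norm_diagonalMultilinear_apply_single (hm : 0 < m) {f : ∀ k, ℕ → X k →L[𝕂] 𝕂}
    {n : ℕ} (z : Fin n → Y) {a : Fin m → ℕ → 𝕂} {u : ∀ k, ℕ → X k}
    (hu : ∀ k i j, f k j (u k i) = if j = i then a k i else 0) (i : Fin n) :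
    ‖diagonalMultilinear f z fun k => u k i‖ = (∏ k, ‖a k i‖) * ‖z i‖ := by
  rw [diagonalMultilinear_apply, Finset.sum_eq_single i]
  · simp [hu, norm_smul]
  · intro j _ hj
    rw [Finset.prod_eq_zero (Finset.mem_univ (⟨0, hm⟩ : Fin m)), zero_smul]
    rw [hu, if_neg]
    exact fun h => hj (Fin.ext h)
  · simp

theorem norm_diagonalMultilinear_apply_le {p : ℝ} {n : ℕ} {y : Fin n → Y}
    (hy : ∀ a : Fin n → 𝕂, ‖∑ j, a j • y j‖ ≤ (∑ j, ‖a j‖ ^ p) ^ (1 / p))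
    (f : ∀ k, ℕ → X k →L[𝕂] 𝕂) (c : Fin n → 𝕂) (x : ∀ k, X k) :
    ‖diagonalMultilinear f (fun j => c j • y j) x‖ ≤
      (∑ j : Fin n, ((∏ k, ‖f k j (x k)‖) * ‖c j‖) ^ p) ^ (1 / p) := by
  rw [diagonalMultilinear_apply]
  have h := hy fun j => (∏ k, f k j (x k)) * c j
  simpa only [mul_smul, norm_mul, norm_prod] using h

end Diagonal

theorem FinitelyFactorsLpLinf.exists_norm_ge {𝕂 : Type*} [RCLike 𝕂] {Y : Type*}
    [NormedAddCommGroup Y] [NormedSpace 𝕂 Y] {p δ : ℝ} (hδ1 : δ < 1)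
    (h : FinitelyFactorsLpLinf 𝕂 Y p δ) :
    ∃ y : ∀ n, Fin n → Y, (∀ n j, 1 - δ ≤ ‖y n j‖) ∧
      ∀ n (a : Fin n → 𝕂), ‖∑ j, a j • y n j‖ ≤ (∑ j, ‖a j‖ ^ p) ^ (1 / p) := by
  classical
  choose y hy using h
  refine ⟨y, fun n i => ?_, fun n a => (hy n a).2⟩
  have h1 := (hy n (Pi.single i 1)).1
  have h2 : ‖(Pi.single i 1 : Fin n → 𝕂) i‖ ≤ ⨆ j, ‖(Pi.single i 1 : Fin n → 𝕂) j‖ :=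
    le_ciSup (f := fun j => ‖(Pi.single i 1 : Fin n → 𝕂) j‖) (Set.finite_range _).bddAbove i
  have h3 : ∑ j, (Pi.single i 1 : Fin n → 𝕂) j • y n j = y n i := by
    rw [Finset.sum_eq_single i (fun j _ hj => by simp [hj]) (by simp)]
    simp
  rw [h3] at h1
  simp only [Pi.single_eq_same, norm_one] at h2
  nlinarith

theorem summable_rpow_of_le {b : ℕ → ℝ} (hb : ∀ j, 0 ≤ b j) {s t : ℝ} (hs : 0 < s)
    (hst : s ≤ t) (h : Summable fun j => b j ^ s) : Summable fun j => b j ^ t := by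
  refine h.of_norm_bounded_eventually_nat ?_
  filter_upwards [h.tendsto_atTop_zero.eventually (gt_mem_nhds one_pos)] with j hj
  have hb1 : b j ≤ 1 := by
    by_contra! hlt
    exact absurd hj (not_lt.2 (Real.one_le_rpow hlt.le hs.le))
  rw [Real.norm_of_nonneg (Real.rpow_nonneg (hb j) t)]
  exact Real.rpow_le_rpow_of_exponent_ge' (hb j) hb1 hs.le hst

/-- If every continuous multilinear map is absolutely `(q;1)`-summing, the coefficients of
diagonal maps are controlled by their norms. -/
theorem exists_sum_coeff_rpow_le {𝕂 : Type*} [RCLike 𝕂] {m : ℕ} (hm : 0 < m)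
    {X : Fin m → Type*} [∀ k, NormedAddCommGroup (X k)] [∀ k, NormedSpace 𝕂 (X k)]
    {Y : Type*} [NormedAddCommGroup Y] [NormedSpace 𝕂 Y] [CompleteSpace Y]
    {q δ : ℝ} (hq : 0 < q) (hδ1 : δ < 1)
    (hsum : ∀ T : ContinuousMultilinearMap 𝕂 X Y,
      ∀ x : ∀ k, ℕ → X k, (∀ k, WeaklySummable 𝕂 (x k)) →
        Summable fun j => ‖T fun k => x k j‖ ^ q)
    {f : ∀ k, ℕ → X k →L[𝕂] 𝕂} {a : Fin m → ℕ → 𝕂} {u : ∀ k, ℕ → X k}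
    (hu : ∀ k i j, f k j (u k i) = if j = i then a k i else 0)
    (huw : ∀ k, WeaklySummable 𝕂 (u k))
    {y : ∀ n, Fin n → Y} (hy : ∀ n j, 1 - δ ≤ ‖y n j‖) :
    ∃ K : ℝ, 0 ≤ K ∧ ∀ (n : ℕ) (c : Fin n → 𝕂) (M : ℝ),
      ‖diagonalMultilinear f fun j => c j • y n j‖ ≤ M →
        ∑ j : Fin n, ((∏ k, ‖a k j‖) * ‖c j‖) ^ q ≤ K * M ^ q := by
  have hδ : 0 < 1 - δ := sub_pos.2 hδ1
  obtain ⟨K, hK, hKT⟩ := exists_sum_rpow_norm_le_of_summable hq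
    (fun j => ContinuousMultilinearMap.apply 𝕂 X Y fun k => u k j)
    (fun T => hsum T u huw)
  refine ⟨K / (1 - δ) ^ q, by positivity, fun n c M hM => ?_⟩
  rw [div_mul_eq_mul_div, le_div_iff₀ (by positivity), Finset.sum_mul]
  have hM' : K * ‖diagonalMultilinear f fun j => c j • y n j‖ ^ q ≤ K * M ^ q := by gcongr
  refine le_trans (Finset.sum_le_sum fun j _ => ?_) ((hKT _ n).trans hM')
  rw [ContinuousMultilinearMap.apply_apply,
    norm_diagonalMultilinear_apply_single hm _ hu j, norm_smul,
    ← Real.mul_rpow (by positivity) hδ.le, ← mul_assoc]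
  have := hy n j
  gcongr

theorem Real.le_rpow_of_le_mul_rpow {S G r : ℝ} (hS : 0 ≤ S) (hG : 0 ≤ G) (hr : r < 1)
    (h : S ≤ G * S ^ r) : S ≤ G ^ (1 / (1 - r)) := by
  rcases hS.eq_or_lt with rfl | hS
  · positivity
  have hr' : 0 < 1 - r := sub_pos.2 hr
  have h1 : S ^ (1 - r) ≤ G := by
    rwa [Real.rpow_sub hS, Real.rpow_one, div_le_iff₀ (by positivity)]
  calc S = (S ^ (1 - r)) ^ (1 / (1 - r)) := by
        rw [← Real.rpow_mul hS.le, mul_one_div_cancel hr'.ne', Real.rpow_one]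
    _ ≤ G ^ (1 / (1 - r)) := by gcongr

/-- Multilinear version: if `Y` finitely factors `ℓ_p → ℓ_∞` and every continuous `m`-linear
mapping from `X₁ × ⋯ × X_m` into `Y` is absolutely `(q;1)`-summing, then (a) if `q < p`, the
products of basis coefficients are `t`-summable for all `t > pq/(p-q)`; (b) if `q ≤ p/2`, the
same holds for all `t > q`. -/
theorem stmt11 (𝕂 : Type*) [RCLike 𝕂] (m : ℕ) (hm : 0 < m)
    (X : Fin m → Type*) [∀ k, NormedAddCommGroup (X k)]
    [∀ k, NormedSpace 𝕂 (X k)] [∀ k, CompleteSpace (X k)]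
    (hX : ∀ k, ¬FiniteDimensional 𝕂 (X k))
    (Y : Type*) [NormedAddCommGroup Y] [NormedSpace 𝕂 Y] [CompleteSpace Y]
    (hY : ¬FiniteDimensional 𝕂 Y)
    (e : ∀ k, ℕ → X k) (he : ∀ k, IsNormalizedUncondBasis 𝕂 (X k) (e k))
    (q p δ : ℝ) (hq : 0 < q) (hp : 1 ≤ p)
    (hδ0 : 0 < δ) (hδ1 : δ < 1) (hff : FinitelyFactorsLpLinf 𝕂 Y p δ)
    (hsum : ∀ T : ContinuousMultilinearMap 𝕂 X Y,
      ∀ x : ∀ k, ℕ → X k, (∀ k, WeaklySummable 𝕂 (x k)) →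
        Summable fun j => ‖T fun k => x k j‖ ^ q) :
    (q < p → ∀ t : ℝ, p * q / (p - q) < t → ∀ (x : ∀ k, X k) (a : ∀ _ : Fin m, ℕ → 𝕂),
      (∀ k, HasSum (fun j => a k j • e k j) (x k)) →
        Summable fun j => (∏ k, ‖a k j‖) ^ t) ∧
    (q ≤ p / 2 → ∀ t : ℝ, q < t → ∀ (x : ∀ k, X k) (a : ∀ _ : Fin m, ℕ → 𝕂),
      (∀ k, HasSum (fun j => a k j • e k j) (x k)) →
        Summable fun j => (∏ k, ‖a k j‖) ^ t) := by
  choose f C hC hfC hfsum hfuniq using fun k => (he k).exists_coord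
  obtain ⟨y, hy1, hy2⟩ := hff.exists_norm_ge hδ1
  have hp0 : 0 < p := by linarith
  have hcoord : ∀ (a : Fin m → ℕ → 𝕂) k i j,
      f k j (a k i • e k i) = if j = i then a k i else 0 := by
    intro a k i j
    refine hfuniq k (a k i • e k i) (fun j => if j = i then a k i else 0) ?_ j
    convert (hasSum_ite_eq i (a k i • e k i)) using 1
    funext j
    by_cases h : j = i <;> simp [h]
  have hdiag : ∀ (x : ∀ k, X k) (a : Fin m → ℕ → 𝕂),
      (∀ k, HasSum (fun j => a k j • e k j) (x k)) →
      ∃ K : ℝ, 0 ≤ K ∧ ∀ (n : ℕ) (c : Fin n → 𝕂) (M : ℝ),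
        ‖diagonalMultilinear f fun j => c j • y n j‖ ≤ M →
          ∑ j : Fin n, ((∏ k, ‖a k j‖) * ‖c j‖) ^ q ≤ K * M ^ q := fun x a hxa =>
    exists_sum_coeff_rpow_le hm hq hδ1 hsum (hcoord a)
      (fun k => (hxa k).weaklySummable) hy1
  have hweak : q < p → ∀ (x : ∀ k, X k) (a : Fin m → ℕ → 𝕂),
      (∀ k, HasSum (fun j => a k j • e k j) (x k)) →
        Summable fun j => (∏ k, ‖a k j‖) ^ (p * q / (p - q)) := by
    intro hqp x a hxa
    have hpq : 0 < p - q := sub_pos.2 hqp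
    obtain ⟨K, hK, hKc⟩ := hdiag x a hxa
    have hb : ∀ j, 0 ≤ ∏ k, ‖a k j‖ := fun j => Finset.prod_nonneg fun _ _ => norm_nonneg _
    have hD : 0 ≤ ∏ k, C k := Finset.prod_nonneg fun k _ => hC k
    refine summable_of_sum_range_le (c := (K * (∏ k, C k) ^ q) ^ (1 / (1 - q / p)))
      (fun j => Real.rpow_nonneg (hb j) _) fun n => ?_
    rw [← Fin.sum_univ_eq_sum_range (fun j => (∏ k, ‖a k j‖) ^ (p * q / (p - q))) n]
    set S := ∑ j : Fin n, (∏ k, ‖a k j‖) ^ (p * q / (p - q)) with hS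
    have hS0 : 0 ≤ S := Finset.sum_nonneg fun j _ => Real.rpow_nonneg (hb j) _
    have hcn : ∀ j, ‖(((∏ k, ‖a k j‖) ^ (q / (p - q)) : ℝ) : 𝕂)‖ =
        (∏ k, ‖a k j‖) ^ (q / (p - q)) := fun j => by
      rw [RCLike.norm_ofReal, abs_of_nonneg (Real.rpow_nonneg (hb j) _)]
    have hnorm : ‖diagonalMultilinear f fun j : Fin n =>
        (((∏ k, ‖a k j‖) ^ (q / (p - q)) : ℝ) : 𝕂) • y n j‖ ≤ (∏ k, C k) * S ^ (1 / p) := by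
      refine ContinuousMultilinearMap.opNorm_le_bound (by positivity) fun z => ?_
      refine (norm_diagonalMultilinear_apply_le (hy2 n) f _ z).trans ?_
      have hsumle : ∑ j : Fin n, ((∏ k, ‖f k j (z k)‖) *
          ‖(((∏ k, ‖a k j‖) ^ (q / (p - q)) : ℝ) : 𝕂)‖) ^ p ≤
          ((∏ k, C k) * ∏ k, ‖z k‖) ^ p * S := by
        rw [hS, Finset.mul_sum]
        refine Finset.sum_le_sum fun j _ => ?_
        rw [hcn, Real.mul_rpow (by positivity) (Real.rpow_nonneg (hb j) _),
          ← Real.rpow_mul (hb j), div_mul_eq_mul_div, mul_comm q p, ← Finset.prod_mul_distrib]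
        have := Real.rpow_nonneg (hb j) (p * q / (p - q))
        gcongr with k
        exact hfC k j (z k)
      calc _ ≤ (((∏ k, C k) * ∏ k, ‖z k‖) ^ p * S) ^ (1 / p) :=
            Real.rpow_le_rpow (by positivity) hsumle (by positivity)
        _ = (∏ k, C k) * S ^ (1 / p) * ∏ k, ‖z k‖ := by
            rw [Real.mul_rpow (by positivity) hS0, ← Real.rpow_mul (by positivity),
              mul_one_div_cancel hp0.ne', Real.rpow_one]
            ring
    refine Real.le_rpow_of_le_mul_rpow hS0 (by positivity) ((div_lt_one hp0).2 hqp) ?_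
    have h := hKc n _ _ hnorm
    rw [Real.mul_rpow hD (by positivity), ← Real.rpow_mul hS0, one_div_mul_eq_div,
      ← mul_assoc] at h
    refine le_trans (le_of_eq (Finset.sum_congr rfl fun j _ => ?_)) h
    rw [hcn, Real.mul_rpow (hb j) (Real.rpow_nonneg (hb j) _), ← Real.rpow_mul (hb j),
      ← Real.rpow_add_of_nonneg (hb j) hq.le (by positivity)]
    congr 1
    field_simp
    ring
  refine ⟨fun hqp t ht x a hxa => ?_, fun hqp t ht x a hxa => ?_⟩
  · have hpq : 0 < p - q := sub_pos.2 hqp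
    exact summable_rpow_of_le (fun j => by positivity) (by positivity) ht.le (hweak hqp x a hxa)
  have hlt : q < p := by linarith
  have hpq : 0 < p - q := sub_pos.2 hlt
  obtain ⟨M, hM, hMn⟩ := ContinuousMultilinearMap.banach_steinhaus
    (fun n => diagonalMultilinear f fun j : Fin n => (1 : 𝕂) • y n j) fun z => by
      have hz : Summable fun j => (∏ k, ‖f k j (z k)‖) ^ p :=
        summable_rpow_of_le (fun j => by positivity) (by positivity)
          (by rw [div_le_iff₀ hpq]; nlinarith) (hweak hlt z _ fun k => hfsum k (z k))
      refine ⟨(∑' j, (∏ k, ‖f k j (z k)‖) ^ p) ^ (1 / p), fun n => ?_⟩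
      refine (norm_diagonalMultilinear_apply_le (hy2 n) f _ z).trans ?_
      refine Real.rpow_le_rpow (by positivity) ?_ (by positivity)
      simp only [norm_one, mul_one]
      rw [Fin.sum_univ_eq_sum_range (fun j => (∏ k, ‖f k j (z k)‖) ^ p) n]
      exact hz.sum_le_tsum _ fun _ _ => by positivity
  obtain ⟨K, hK, hKc⟩ := hdiag x a hxa
  refine summable_rpow_of_le (fun j => by positivity) hq ht.le
    (summable_of_sum_range_le (c := K * M ^ q) (fun j => by positivity) fun n => ?_)
  rw [← Fin.sum_univ_eq_sum_range (fun j => (∏ k, ‖a k j‖) ^ q) n]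
  simpa using hKc n (fun _ => 1) M (hMn n)
end

section
/- Let X₁,…,X_m be infinite dimensional Banach spaces with normalized unconditional Schauder bases (x_n^{(k)}), k = 1,…,m, let n₁,…,n_m ≥ 1, let 0 < q < 1, and let Y be a nonzero finite dimensional Banach space. If every continuous (n₁,…,n_m)-homogeneous polynomial from X₁ × ⋯ × X_m into Y is absolutely (q;1)-summing, then for every t > q and all x_k = ∑_j a_j^{(k)} x_j^{(k)} ∈ X_k (k = 1,…,m) one has ∑_j (∏_{k=1}^m |a_j^{(k)}|^{n_k})^t < ∞. -/
open scoped BigOperators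

/-- `P` is a continuous `(n 0, …, n (m-1))`-homogeneous polynomial, i.e. it comes from a
continuous multilinear map in `n 0 + ⋯ + n (m-1)` variables (`n k` copies of `X k`). -/
def IsMultiPoly (𝕂 : Type*) [RCLike 𝕂] {m : ℕ} (n : Fin m → ℕ)
    {X : Fin m → Type*} [∀ k, NormedAddCommGroup (X k)] [∀ k, NormedSpace 𝕂 (X k)]
    {Y : Type*} [NormedAddCommGroup Y] [NormedSpace 𝕂 Y]
    (P : (∀ k, X k) → Y) : Prop :=
  ∃ T : ContinuousMultilinearMap 𝕂 (fun i : Σ k : Fin m, Fin (n k) => X i.1) Y,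
    ∀ x : ∀ k, X k, P x = T fun i => x i.1

theorem ContinuousMultilinearMap.exists_forall_bound_of_pointwise {𝕜 ι α : Type*}
    [NontriviallyNormedField 𝕜] [Fintype ι] {E : ι → Type*} [∀ i, NormedAddCommGroup (E i)]
    [∀ i, NormedSpace 𝕜 (E i)] [∀ i, CompleteSpace (E i)] {G : Type*} [NormedAddCommGroup G]
    [NormedSpace 𝕜 G] (f : α → ContinuousMultilinearMap 𝕜 E G)
    (h : ∀ v, ∃ C, ∀ a, ‖f a v‖ ≤ C) :
    ∃ C, ∀ a v, ‖f a v‖ ≤ C * ∏ i, ‖v i‖ := by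
  classical
  obtain ⟨N, v₀, hv₀⟩ : ∃ N : ℕ, (interior {v | ∀ a, ‖f a v‖ ≤ N}).Nonempty := by
    apply nonempty_interior_of_iUnion_of_closed
    · intro N
      simp only [Set.ofPred_forall]
      exact isClosed_iInter fun a => isClosed_le (f a).cont.norm continuous_const
    · rw [Set.eq_univ_iff_forall]
      intro v
      obtain ⟨C, hC⟩ := h v
      obtain ⟨N, hN⟩ := exists_nat_ge C
      exact Set.mem_iUnion.2 ⟨N, fun a => (hC a).trans hN⟩
  obtain ⟨ε, hε, hball⟩ := Metric.isOpen_iff.1 isOpen_interior v₀ hv₀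
  have key : ∀ (s : Finset ι) (v : ∀ i, E i), (∀ i ∈ s, ‖v i‖ < ε) →
      (∀ i ∉ s, ‖v i - v₀ i‖ < ε) → ∀ a, ‖f a v‖ ≤ 2 ^ s.card * N := by
    intro s
    induction s using Finset.induction_on with
    | empty =>
      intro v _ hv a
      have : v ∈ Metric.ball v₀ ε := by
        rw [Metric.mem_ball, dist_pi_lt_iff hε]
        intro i
        rw [dist_eq_norm]
        exact hv i (by simp)
      simpa using interior_subset (hball this) a
    | insert i s hi ih =>
      intro v hv hv' a
      have e : f a v = f a (Function.update v i (v i + v₀ i))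
          - f a (Function.update v i (v₀ i)) := by
        rw [← (f a).map_update_sub]
        simp
      have hz : ∀ z, ‖z - v₀ i‖ < ε → ‖f a (Function.update v i z)‖ ≤ 2 ^ s.card * N := by
        intro z hz
        refine ih _ (fun j hj => ?_) (fun j hj => ?_) a
        · have : j ≠ i := fun h => hi (h ▸ hj)
          rw [Function.update_of_ne this]
          exact hv j (Finset.mem_insert_of_mem hj)
        · by_cases hji : j = i
          · subst hji
            simpa using hz
          · rw [Function.update_of_ne hji]
            exact hv' j (by simp [hji, hj])
      have h1 := hz (v i + v₀ i) (by simpa using hv i (Finset.mem_insert_self _ _))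
      have h2 := hz (v₀ i) (by simpa using hε)
      rw [e, Finset.card_insert_of_notMem hi]
      calc _ ≤ _ := norm_sub_le _ _
        _ ≤ _ := add_le_add h1 h2
        _ = _ := by ring
  obtain ⟨c, hc⟩ := NormedField.exists_one_lt_norm 𝕜
  have hc0 : 0 < ‖c‖ := one_pos.trans hc
  refine ⟨2 ^ Fintype.card ι * N * ∏ _i : ι, (‖c‖ / ε), fun a v => ?_⟩
  refine (f a).toMultilinearMap.bound_of_shell (fun _ => hε) (fun _ => hc)
    (fun v hv hv' => ?_) v
  have h1 := key Finset.univ v (fun i _ => hv' i) (by simp) a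
  refine h1.trans ?_
  rw [mul_assoc _ _ (∏ i, ‖v i‖), ← Finset.prod_mul_distrib, Finset.card_univ]
  refine le_mul_of_one_le_right (by positivity) ?_
  refine Finset.one_le_prod fun i _ => ?_
  rw [div_mul_eq_mul_div, one_le_div hε, mul_comm]
  have := hv i
  rwa [div_le_iff₀ hc0] at this

theorem Real.sub_div_rpow_le {u v r : ℝ} (hu : 0 < u) (huv : u ≤ v) (hr : 0 < r) :
    (v - u) / v ^ (1 + r) ≤ (u ^ (-r) - v ^ (-r)) / r := by
  have hv : 0 < v := hu.trans_le huv
  have h1 : 1 + r * ((v - u) / v) ≤ (u / v) ^ (-r) := by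
    rw [Real.rpow_def_of_pos (by positivity)]
    have h2 := Real.log_le_sub_one_of_pos (div_pos hu hv)
    have h3 := Real.add_one_le_exp (Real.log (u / v) * -r)
    have h4 : (v - u) / v = 1 - u / v := by field_simp
    rw [h4]
    nlinarith
  rw [Real.div_rpow hu.le hv.le, le_div_iff₀ (by positivity)] at h1
  rw [le_div_iff₀ hr]
  have h5 : v ^ (1 + r) = v / v ^ (-r) := by
    rw [Real.rpow_add hv, Real.rpow_one, Real.rpow_neg hv.le, div_inv_eq_mul]
  rw [h5]
  have h6 : (v - u) / (v / v ^ (-r)) * r = r * ((v - u) / v) * v ^ (-r) := by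
    field_simp
  rw [h6]
  linarith

/-- A form of the Abel–Dini theorem, convergent part. -/
theorem summable_div_sum_rpow {c : ℕ → ℝ} (hc : ∀ j, 0 ≤ c j) {p : ℝ} (hp : 1 < p) :
    Summable fun j => c j / (1 + ∑ i ∈ Finset.range (j + 1), c i) ^ p := by
  set S : ℕ → ℝ := fun j => 1 + ∑ i ∈ Finset.range j, c i
  have hS : ∀ j, 0 < S j := fun j =>
    add_pos_of_pos_of_nonneg one_pos (Finset.sum_nonneg fun i _ => hc i)
  have hr : 0 < p - 1 := sub_pos.2 hp
  have hsucc : ∀ j, S (j + 1) = S j + c j := fun j => by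
    simp only [S, Finset.sum_range_succ]; ring
  have hterm : ∀ j, c j / S (j + 1) ^ p ≤
      (S j ^ (-(p - 1)) - S (j + 1) ^ (-(p - 1))) / (p - 1) := by
    intro j
    have := Real.sub_div_rpow_le (v := S (j + 1)) (hS j) (by linarith [hsucc j, hc j]) hr
    rwa [hsucc j, add_sub_cancel_left, add_sub_cancel, ← hsucc] at this
  refine summable_of_sum_range_le (c := 1 / (p - 1))
    (fun j => div_nonneg (hc j) (Real.rpow_nonneg (hS _).le _)) fun N => ?_
  refine (Finset.sum_le_sum fun j _ => hterm j).trans ?_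
  rw [← Finset.sum_div, Finset.sum_range_sub']
  have h0 : S 0 = 1 := by simp [S]
  rw [h0, Real.one_rpow]
  have := Real.rpow_nonneg (hS N).le (-(p - 1))
  gcongr
  linarith

/-- A form of the Abel–Dini theorem, divergent part. -/
theorem summable_of_summable_div_sum {c : ℕ → ℝ} (hc : ∀ j, 0 ≤ c j)
    (h : Summable fun j => c j / (1 + ∑ i ∈ Finset.range (j + 1), c i)) : Summable c := by
  set S : ℕ → ℝ := fun j => 1 + ∑ i ∈ Finset.range j, c i
  have hS : ∀ j, 0 < S j := fun j =>
    add_pos_of_pos_of_nonneg one_pos (Finset.sum_nonneg fun i _ => hc i)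
  have hmono : Monotone S := monotone_nat_of_le_succ fun j => by
    simp only [S, Finset.sum_range_succ]; linarith [hc j]
  have hnn : ∀ j, 0 ≤ c j / S (j + 1) := fun j => div_nonneg (hc j) (hS _).le
  obtain ⟨M, hM⟩ := ((tendsto_sum_nat_add fun j => c j / S (j + 1)).eventually
    (gt_mem_nhds (show (0 : ℝ) < 1 / 2 by norm_num))).exists
  have htail : ∀ N, S (N + M) ≤ 2 * S M := by
    intro N
    have h1 : S (N + M) - S M = ∑ i ∈ Finset.range N, c (i + M) := by
      simp only [S]
      rw [add_comm N M, Finset.sum_range_add]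
      simp only [add_comm M]
      ring
    have h2 : ∑ i ∈ Finset.range N, c (i + M)
        ≤ ∑ i ∈ Finset.range N, c (i + M) / S (i + M + 1) * S (N + M) := by
      refine Finset.sum_le_sum fun i hi => ?_
      rw [div_mul_eq_mul_div, le_div_iff₀ (hS _)]
      exact mul_le_mul_of_nonneg_left
        (hmono (by have := Finset.mem_range.1 hi; omega)) (hc _)
    rw [← Finset.sum_mul] at h2
    have h3 : ∑ i ∈ Finset.range N, c (i + M) / S (i + M + 1)
        ≤ ∑' i, c (i + M) / S (i + M + 1) :=
      ((summable_nat_add_iff M).2 h).sum_le_tsum _ fun i _ => hnn _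
    have h4 := hS (N + M)
    nlinarith
  refine summable_of_sum_range_le (c := 2 * S M) hc fun N => ?_
  have h1 := hmono (Nat.le_add_right N M)
  have h2 := htail N
  have h3 : S N = 1 + ∑ i ∈ Finset.range N, c i := rfl
  linarith

theorem Summable.rpow_of_le {d : ℕ → ℝ} (hd : ∀ j, 0 ≤ d j) {s t : ℝ} (hs : 0 < s) (hst : s ≤ t)
    (h : Summable fun j => d j ^ s) : Summable fun j => d j ^ t := by
  refine Summable.of_norm_bounded_eventually_nat h ?_
  filter_upwards [h.tendsto_atTop_zero.eventually (gt_mem_nhds one_pos)] with j hj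
  have h1 : d j ≤ 1 := by
    by_contra! hlt
    exact absurd (Real.one_lt_rpow hlt hs) hj.le.not_gt
  rw [Real.norm_of_nonneg (Real.rpow_nonneg (hd j) _)]
  exact Real.rpow_le_rpow_of_exponent_ge' (hd j) h1 hs.le hst

/-- Bootstrapping: if `λ ↦ λ d` maps admissible weights into `ℓ_q` with `q < 1`, then the
sequences `d` are in `ℓ_q`. -/
theorem summable_rpow_of_weighted {V : Type*} {D : V → ℕ → ℝ} (hD : ∀ x j, 0 ≤ D x j)
    (hbdd : ∀ x, ∃ C, ∀ j, D x j ≤ C) {q : ℝ} (hq : 0 < q) (hq1 : q < 1)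
    (h : ∀ w : ℕ → ℝ, (∀ j, 0 ≤ w j) → (∀ x, Summable fun j => w j * D x j) →
      ∀ x, Summable fun j => (w j * D x j) ^ q) (x : V) :
    Summable fun j => D x j ^ q := by
  have hone : (∀ x, Summable fun j => D x j) → ∀ x, Summable fun j => D x j ^ q := by
    intro h1 x
    simpa using h (fun _ => 1) (fun _ => zero_le_one) (by simpa using h1) x
  have hstep : ∀ s : ℝ, 1 < s → (∀ x, Summable fun j => D x j ^ s) →
      ∀ x, Summable fun j => D x j ^ (s * q) := by
    intro s hs hsum x
    have hs0 : 0 < s := one_pos.trans hs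
    have := h (fun j => D x j ^ (s - 1)) (fun j => Real.rpow_nonneg (hD x j) _) (fun z => ?_) x
    · refine this.congr fun j => ?_
      rw [mul_comm s q, mul_comm, mul_comm q, Real.rpow_mul (hD x j)]
      congr 1
      nth_rw 1 [← Real.rpow_one (D x j)]
      rw [← Real.rpow_add_of_nonneg (hD x j) zero_le_one (by linarith)]
      congr 1
      ring
    · refine Summable.of_nonneg_of_le
        (fun j => mul_nonneg (Real.rpow_nonneg (hD x j) _) (hD z j)) (fun j => ?_)
        ((hsum x).add (hsum z))
      have hmax : 0 ≤ max (D x j) (D z j) := (hD x j).trans (le_max_left _ _)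
      calc D x j ^ (s - 1) * D z j
          ≤ max (D x j) (D z j) ^ (s - 1) * max (D x j) (D z j) := by
            exact mul_le_mul (Real.rpow_le_rpow (hD x j) (le_max_left _ _) (by linarith))
              (le_max_right _ _) (hD z j) (Real.rpow_nonneg hmax _)
        _ = max (D x j) (D z j) ^ s := by
            nth_rw 2 [← Real.rpow_one (max (D x j) (D z j))]
            rw [← Real.rpow_add_of_nonneg hmax (by linarith) zero_le_one]
            congr 1
            ring
        _ ≤ _ := by
            have h1 := Real.rpow_nonneg (hD x j) s
            have h2 := Real.rpow_nonneg (hD z j) s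
            rcases max_choice (D x j) (D z j) with h | h <;> rw [h] <;> linarith
  have hiter : ∀ (N : ℕ) (s : ℝ), 0 < s → s * q ^ N ≤ 1 → (∀ x, Summable fun j => D x j ^ s) →
      ∀ x, Summable fun j => D x j ^ q := by
    intro N
    induction N with
    | zero =>
      intro s hs hs1 hsum
      refine hone fun x => ?_
      simpa using (hsum x).rpow_of_le (hD x) hs (t := 1) (by simpa using hs1)
    | succ N ih =>
      intro s hs hs1 hsum
      rcases le_or_gt s 1 with hle | hlt
      · refine hone fun x => ?_
        simpa using (hsum x).rpow_of_le (hD x) hs hle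
      · exact ih (s * q) (by positivity) (by rw [pow_succ'] at hs1; linarith) (hstep s hlt hsum)
  have hq' : 0 < 1 - q := sub_pos.2 hq1
  have hs : 0 < q / (1 - q) := div_pos hq hq'
  obtain ⟨N, hN⟩ := exists_pow_lt_of_lt_one (inv_pos.2 hs) hq1
  refine hiter N _ hs ?_ (fun x => ?_) x
  · rw [lt_inv_comm₀ (by positivity) hs] at hN
    rw [← le_div_iff₀ (by positivity), one_div]
    exact hN.le
  set c : ℕ → ℝ := fun j => D x j ^ (q / (1 - q)) with hcdef
  have hc : ∀ j, 0 ≤ c j := fun j => Real.rpow_nonneg (hD x j) _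
  have hS : ∀ j, 0 ≤ 1 + ∑ i ∈ Finset.range j, c i := fun j =>
    add_nonneg zero_le_one (Finset.sum_nonneg fun i _ => hc i)
  refine summable_of_summable_div_sum hc ?_
  have hw : ∀ j, 0 ≤ c j / (1 + ∑ i ∈ Finset.range (j + 1), c i) ^ (1 / q) := fun j =>
    div_nonneg (hc j) (Real.rpow_nonneg (hS _) _)
  refine (h _ hw (fun z => ?_) x).congr fun j => ?_
  · obtain ⟨C, hC⟩ := hbdd z
    exact Summable.of_nonneg_of_le (fun j => mul_nonneg (hw j) (hD z j))
      (fun j => mul_le_mul_of_nonneg_left (hC j) (hw j))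
      ((summable_div_sum_rpow hc (by rwa [lt_div_iff₀ hq, one_mul])).mul_right C)
  · rw [Real.mul_rpow (hw j) (hD x j), Real.div_rpow (hc j) (Real.rpow_nonneg (hS _) _),
      ← Real.rpow_mul (hS _), one_div_mul_cancel hq.ne', Real.rpow_one, div_mul_eq_mul_div]
    congr 1
    simp only [hcdef]
    rw [← Real.rpow_mul (hD x j), ← Real.rpow_add_of_nonneg (hD x j) (by positivity) hq.le]
    congr 1
    field_simp
    ring

namespace IsNormalizedUncondBasis

variable {𝕂 : Type*} [RCLike 𝕂] {X : Type*} [NormedAddCommGroup X] [NormedSpace 𝕂 X] {e : ℕ → X}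

theorem exists_norm_coeff_le (he : IsNormalizedUncondBasis 𝕂 X e) :
    ∃ ρ : ℝ, 0 ≤ ρ ∧ ∀ (a : ℕ → 𝕂) (x : X), HasSum (fun n => a n • e n) x →
      ∀ j, ‖a j‖ ≤ ρ * ‖x‖ := by
  obtain ⟨hn, -, ρ, hρ, H⟩ := he
  refine ⟨ρ, by linarith, fun a x hx j => ?_⟩
  have hflip : HasSum (fun n => (Function.update (1 : ℕ → 𝕂) j (-1) n * a n) • e n)
      (x - (2 * a j) • e j) := by
    refine (hx.sub (hasSum_ite_eq j ((2 * a j) • e j))).congr_fun fun n => ?_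
    by_cases h : n = j
    · subst h
      simp only [Function.update_self, if_true, ← sub_smul]
      congr 1
      ring
    · simp [h]
  have h1 := H a _ x _ (fun n => by by_cases h : n = j <;> simp [h]) hx hflip
  have h2 : ‖(2 * a j) • e j‖ = 2 * ‖a j‖ := by simp [norm_smul, hn]
  have h3 : ‖(2 * a j) • e j‖ ≤ ‖x‖ + ‖x - (2 * a j) • e j‖ := by
    simpa using norm_sub_le x (x - (2 * a j) • e j)
  nlinarith [norm_nonneg x]

/-- The coefficient functionals of an unconditional basis. -/
theorem exists_coeff (he : IsNormalizedUncondBasis 𝕂 X e) :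
    ∃ (c : ℕ → X →L[𝕂] 𝕂) (ρ : ℝ), 0 ≤ ρ ∧ (∀ j x, ‖c j x‖ ≤ ρ * ‖x‖) ∧
      ∀ (a : ℕ → 𝕂) (x : X), HasSum (fun n => a n • e n) x → ∀ j, c j x = a j := by
  obtain ⟨ρ, hρ, hb⟩ := he.exists_norm_coeff_le
  choose b hb1 hb2 using he.2.1
  refine ⟨fun j => LinearMap.mkContinuous
    { toFun := fun x => b x j
      map_add' := fun x y => ?_
      map_smul' := fun r x => ?_ } ρ (fun x => hb _ _ (hb1 x) j), ρ, hρ,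
    fun j x => hb _ _ (hb1 x) j, fun a x ha j => (congrFun (hb2 x a ha) j).symm⟩
  · refine (congrFun (hb2 (x + y) (b x + b y) ?_) j).symm
    simpa [add_smul] using (hb1 x).add (hb1 y)
  · refine (congrFun (hb2 (r • x) (r • b x) ?_) j).symm
    simpa [mul_smul] using (hb1 x).const_smul r

end IsNormalizedUncondBasis

theorem weaklySummable_of_summable {𝕂 : Type*} [RCLike 𝕂] {X : Type*} [NormedAddCommGroup X]
    [NormedSpace 𝕂 X] {x : ℕ → X} (h : Summable x) : WeaklySummable 𝕂 x := fun φ =>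
  summable_norm_iff.2 (φ.summable h)

/-- A pointwise absolutely convergent series of continuous multilinear forms on Banach spaces
defines a continuous multilinear form. -/
theorem ContinuousMultilinearMap.exists_eq_tsum {𝕜 ι : Type*} [RCLike 𝕜] [Fintype ι]
    {E : ι → Type*} [∀ i, NormedAddCommGroup (E i)] [∀ i, NormedSpace 𝕜 (E i)]
    [∀ i, CompleteSpace (E i)] (f : ℕ → ContinuousMultilinearMap 𝕜 E 𝕜)
    (h : ∀ v, Summable fun j => ‖f j v‖) :
    ∃ T : ContinuousMultilinearMap 𝕜 E 𝕜, ∀ v, T v = ∑' j, f j v := by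
  obtain ⟨C, hC⟩ := exists_forall_bound_of_pointwise
    (fun s : Finset ℕ => ∑ j ∈ s, f j) fun v => ⟨∑' j, ‖f j v‖, fun s => by
      rw [sum_apply]
      exact (norm_sum_le _ _).trans ((h v).sum_le_tsum _ fun _ _ => norm_nonneg _)⟩
  let T : MultilinearMap 𝕜 E 𝕜 :=
    { toFun := fun v => ∑' j, f j v
      map_update_add' := fun v i x y => by
        simp only [ContinuousMultilinearMap.map_update_add]
        exact (h _).of_norm.tsum_add (h _).of_norm
      map_update_smul' := fun v i r x => by
        simp only [ContinuousMultilinearMap.map_update_smul]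
        exact (h _).of_norm.tsum_const_smul r }
  refine ⟨T.mkContinuous C fun v => ?_, fun v => rfl⟩
  refine le_of_tendsto (h v).of_norm.hasSum.norm (Filter.Eventually.of_forall fun s => ?_)
  simpa using hC s v

theorem prod_sigma_le_sum_prod_pow {m : ℕ} {n : Fin m → ℕ} (hn : ∀ k, 1 ≤ n k)
    (b : (Σ k : Fin m, Fin (n k)) → ℝ) (hb : ∀ i, 0 ≤ b i) :
    ∏ i, b i ≤ ∑ g : ∀ k, Fin (n k), ∏ k, b ⟨k, g k⟩ ^ n k := by
  rw [Fintype.prod_sigma, ← Fintype.piFinset_univ,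
    ← Finset.prod_univ_sum (fun k => Finset.univ) fun k (i : Fin (n k)) => b ⟨k, i⟩ ^ n k]
  refine Finset.prod_le_prod (fun k _ => Finset.prod_nonneg fun _ _ => hb _) fun k _ => ?_
  have : Nonempty (Fin (n k)) := ⟨⟨0, hn k⟩⟩
  obtain ⟨i₀, hi₀⟩ := Finite.exists_max fun i : Fin (n k) => b ⟨k, i⟩
  calc ∏ i : Fin (n k), b ⟨k, i⟩ ≤ ∏ _i : Fin (n k), b ⟨k, i₀⟩ :=
        Finset.prod_le_prod (fun _ _ => hb _) fun i _ => hi₀ i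
    _ = b ⟨k, i₀⟩ ^ n k := by simp
    _ ≤ _ := Finset.single_le_sum (f := fun i : Fin (n k) => b ⟨k, i⟩ ^ n k)
        (fun i _ => pow_nonneg (hb _) _) (Finset.mem_univ i₀)

/-- If `Y` is nonzero finite dimensional, `q < 1`, and every continuous
`(n₁,…,n_m)`-homogeneous polynomial into `Y` is absolutely `(q;1)`-summing, then the products
of powers of basis coefficients are `t`-summable for every `t > q`. -/
theorem stmt14 (𝕂 : Type*) [RCLike 𝕂]
    (Y : Type*) [NormedAddCommGroup Y] [NormedSpace 𝕂 Y] [CompleteSpace Y]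
    (hY0 : Nontrivial Y) (hYfd : FiniteDimensional 𝕂 Y)
    (m : ℕ) (hm : 0 < m) (n : Fin m → ℕ) (hn : ∀ k, 1 ≤ n k)
    (X : Fin m → Type*) [∀ k, NormedAddCommGroup (X k)]
    [∀ k, NormedSpace 𝕂 (X k)] [∀ k, CompleteSpace (X k)]
    (e : ∀ k, ℕ → X k) (he : ∀ k, IsNormalizedUncondBasis 𝕂 (X k) (e k))
    (hX : ∀ k, ¬FiniteDimensional 𝕂 (X k))
    (q : ℝ) (hq : 0 < q) (hq1 : q < 1)
    (hsum : ∀ P : (∀ k, X k) → Y, IsMultiPoly 𝕂 n P →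
      ∀ x : ∀ k, ℕ → X k, (∀ k, WeaklySummable 𝕂 (x k)) →
        Summable fun j => ‖P fun k => x k j‖ ^ q)
    (t : ℝ) (ht : q < t) (x : ∀ k, X k) (a : ∀ _ : Fin m, ℕ → 𝕂)
    (ha : ∀ k, HasSum (fun j => a k j • e k j) (x k)) :
    Summable fun j => (∏ k, ‖a k j‖ ^ (n k : ℝ)) ^ t := by
  choose c ρ hρ hcb hc using fun k => (he k).exists_coeff
  have hcoeff : ∀ (z : ∀ k, X k) k, HasSum (fun j => c k j (z k) • e k j) (z k) := fun z k => by
    obtain ⟨b, hb, -⟩ := (he k).2.1 (z k)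
    simpa only [hc k b (z k) hb] using hb
  have hdelta : ∀ k (r : 𝕂) i j, c k i (r • e k j) = if i = j then r else 0 := fun k r i j => by
    refine hc k (fun i => if i = j then r else 0) _ ?_ i
    simpa only [ite_smul, zero_smul] using
      (hasSum_ite_eq j (r • e k j)).congr_fun fun i => by by_cases h : i = j <;> simp [h]
  have hD0 : ∀ (z : ∀ k, X k) j, 0 ≤ ∏ k, ‖c k j (z k)‖ ^ n k := fun z j => by positivity
  have main : Summable fun j => (∏ k, ‖c k j (x k)‖ ^ n k) ^ q := by
    refine summable_rpow_of_weighted (D := fun (z : ∀ k, X k) j => ∏ k, ‖c k j (z k)‖ ^ n k)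
      hD0 (fun z => ⟨∏ k, (ρ k * ‖z k‖) ^ n k, fun j => ?_⟩) hq hq1 (fun w hw hws z => ?_) x
    · exact Finset.prod_le_prod (fun _ _ => by positivity) fun k _ =>
        pow_le_pow_left₀ (norm_nonneg _) (hcb k j _) _
    obtain ⟨y, hy⟩ := exists_ne (0 : Y)
    let f : ℕ → ContinuousMultilinearMap 𝕂 (fun i : Σ k : Fin m, Fin (n k) => X i.1) 𝕂 :=
      fun j => (w j : 𝕂) • (ContinuousMultilinearMap.mkPiAlgebra 𝕂 _ 𝕂).compContinuousLinearMap
        fun i => c i.1 j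
    have hf : ∀ j v, f j v = (w j : 𝕂) * ∏ i, c i.1 j (v i) := fun j v => rfl
    obtain ⟨T, hT⟩ := ContinuousMultilinearMap.exists_eq_tsum f fun v => by
      have hsg : Summable fun j => ∑ g : ∀ k, Fin (n k), w j * ∏ k, ‖c k j (v ⟨k, g k⟩)‖ ^ n k :=
        summable_sum fun g _ => hws fun k => v ⟨k, g k⟩
      refine Summable.of_nonneg_of_le (fun _ => norm_nonneg _) (fun j => ?_) hsg
      rw [hf, norm_mul, RCLike.norm_of_nonneg (hw j), norm_prod, ← Finset.mul_sum]
      exact mul_le_mul_of_nonneg_left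
        (prod_sigma_le_sum_prod_pow hn (fun i => ‖c i.1 j (v i)‖) fun _ => norm_nonneg _) (hw j)
    have hP := hsum (fun u => T (fun i => u i.1) • y) ⟨T.smulRight y, fun _ => rfl⟩
      (fun k j => c k j (z k) • e k j) fun k => weaklySummable_of_summable (hcoeff z k).summable
    have hval : ∀ j, ‖T (fun i => c i.1 j (z i.1) • e i.1 j) • y‖ ^ q
        = (w j * ∏ k, ‖c k j (z k)‖ ^ n k) ^ q * ‖y‖ ^ q := fun j => by
      rw [norm_smul, Real.mul_rpow (norm_nonneg _) (norm_nonneg _), hT,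
        tsum_eq_single j fun i hi => ?_]
      · rw [hf, norm_mul, RCLike.norm_of_nonneg (hw j), norm_prod, Fintype.prod_sigma]
        simp only [hdelta, if_true]
        congr 3
        exact Finset.prod_congr rfl fun k _ => Fin.prod_const (n k) ‖c k j (z k)‖
      · rw [hf, Finset.prod_eq_zero (i := ⟨⟨0, hm⟩, ⟨0, hn _⟩⟩) (Finset.mem_univ _), mul_zero]
        simp [hdelta, hi]
    exact (summable_mul_right_iff (Real.rpow_pos_of_pos (norm_pos_iff.2 hy) q).ne').1
      (hP.congr fun j => hval j)
  refine (main.rpow_of_le (hD0 x) hq ht.le).congr fun j => ?_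
  simp only [Real.rpow_natCast, hc _ _ _ (ha _)]
end
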